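/- arXiv:1708.07259 — 2 statements merged into one kernel-verified Lean document; each statement's English description precedes it below -/
import Mathlib

section
/- Let T = w* β₁*∘β₂*∘β₃* + E ∈ ℝ^{d₁×d₂×d₃} with w* > 0 and unit vectors β₁*, β₂*, β₃*. Let u ∈ ℝ^{d₁}, v ∈ ℝ^{d₂} be unit vectors with ‖u − β₁*‖₂ ≤ ε₀ and ‖v − β₂*‖₂ ≤ ε₀ for some 0 ≤ ε₀ < 1, and let F₁, F₂, F₃ be index sets with supp(u) ∪ supp(β₁*) ⊆ F₁, |F₁| ≤ s₁, supp(v) ∪ supp(β₂*) ⊆ F₂, |F₂| ≤ s₂, supp(β₃*) ⊆ F₃, |F₃| ≤ s₃. If η := η(E; s₁,s₂,s₃) < w*(1 − ε₀²), then the vector ε := Norm(T_F ×₁ u ×₂ v) − β₃* satisfies ‖ε‖∞ ≤ 2η / (w*(1 − ε₀²) − η). -/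
open scoped BigOperators
open Matrix

noncomputable def l2 {d : ℕ} (v : Fin d → ℝ) : ℝ := Real.sqrt (∑ i, v i ^ 2)

noncomputable def linf {d : ℕ} (v : Fin d → ℝ) : ℝ := ⨆ i, |v i|

noncomputable def tv {d : ℕ} (β : Fin d → ℝ) : ℝ :=
  ∑ j ∈ Finset.range (d - 1),
    if h : j + 1 < d then |β ⟨j + 1, h⟩ - β ⟨j, Nat.lt_of_succ_lt h⟩| else 0

noncomputable def contract3 {d₁ d₂ d₃ : ℕ} (T : Fin d₁ × Fin d₂ × Fin d₃ → ℝ)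
    (u : Fin d₁ → ℝ) (v : Fin d₂ → ℝ) : Fin d₃ → ℝ :=
  fun k => ∑ i, ∑ j, T (i, j, k) * u i * v j

def outer3 {d₁ d₂ d₃ : ℕ} (a : Fin d₁ → ℝ) (b : Fin d₂ → ℝ) (c : Fin d₃ → ℝ) :
    Fin d₁ × Fin d₂ × Fin d₃ → ℝ :=
  fun p => a p.1 * b p.2.1 * c p.2.2

noncomputable def eta {d₁ d₂ d₃ : ℕ} (E : Fin d₁ × Fin d₂ × Fin d₃ → ℝ)
    (s₁ s₂ s₃ : ℕ) : ℝ :=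
  sSup { x : ℝ | ∃ (u : Fin d₁ → ℝ) (v : Fin d₂ → ℝ) (w : Fin d₃ → ℝ),
    l2 u = 1 ∧ l2 v = 1 ∧ l2 w = 1 ∧
    (Function.support u).ncard ≤ s₁ ∧ (Function.support v).ncard ≤ s₂ ∧
    (Function.support w).ncard ≤ s₃ ∧
    x = |∑ i, ∑ j, ∑ k, E (i, j, k) * u i * v j * w k| }

noncomputable def restrict3 {d₁ d₂ d₃ : ℕ} (T : Fin d₁ × Fin d₂ × Fin d₃ → ℝ)
    (F₁ : Finset (Fin d₁)) (F₂ : Finset (Fin d₂)) (F₃ : Finset (Fin d₃)) :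
    Fin d₁ × Fin d₂ × Fin d₃ → ℝ :=
  fun p => if p.1 ∈ F₁ ∧ p.2.1 ∈ F₂ ∧ p.2.2 ∈ F₃ then T p else 0

noncomputable def restrictVec {d : ℕ} (v : Fin d → ℝ) (F : Finset (Fin d)) : Fin d → ℝ :=
  fun i => if i ∈ F then v i else 0

noncomputable def vnormalize {d : ℕ} (v : Fin d → ℝ) : Fin d → ℝ :=
  fun i => v i / l2 v

def Dmat (d : ℕ) : Matrix (Fin (d - 1)) (Fin d) ℝ :=
  fun j i => if (i : ℕ) = (j : ℕ) then -1 else if (i : ℕ) = (j : ℕ) + 1 then 1 else 0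

noncomputable def Dpinv (d : ℕ) : Matrix (Fin d) (Fin (d - 1)) ℝ :=
  (Dmat d)ᵀ * (Dmat d * (Dmat d)ᵀ)⁻¹

noncomputable def Mconst (d : ℕ) : ℝ :=
  ⨆ j : Fin (d - 1), l2 (fun i => Dpinv d i j)

def gfun (C₁ ε₀ ξ : ℝ) (R : ℕ) : ℝ :=
  C₁ * ε₀ ^ 2 + 2 * ε₀ * ξ * ((R : ℝ) - 1) + ξ ^ 2 * ((R : ℝ) - 1)

lemma l2_eq_norm {d : ℕ} (v : Fin d → ℝ) : l2 v = ‖(WithLp.toLp 2 v : EuclideanSpace ℝ (Fin d))‖ := by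
  simp [l2, EuclideanSpace.norm_eq]

lemma abs_le_l2 {d : ℕ} (v : Fin d → ℝ) (i : Fin d) : |v i| ≤ l2 v := by
  unfold l2
  apply Real.abs_le_sqrt
  exact Finset.single_le_sum (f := fun i => v i ^ 2) (fun i _ => sq_nonneg _) (Finset.mem_univ i)

lemma l2_sq {d : ℕ} (v : Fin d → ℝ) : l2 v ^ 2 = ∑ i, v i ^ 2 :=
  Real.sq_sqrt (Finset.sum_nonneg fun i _ => sq_nonneg _)

lemma l2_nonneg {d : ℕ} (v : Fin d → ℝ) : 0 ≤ l2 v := Real.sqrt_nonneg _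

lemma eta_nonneg {d₁ d₂ d₃ : ℕ} (E : Fin d₁ × Fin d₂ × Fin d₃ → ℝ) (s₁ s₂ s₃ : ℕ) :
    0 ≤ eta E s₁ s₂ s₃ := by
  apply Real.sSup_nonneg
  rintro x ⟨u, v, w, -, -, -, -, -, -, rfl⟩
  exact abs_nonneg _

lemma le_eta {d₁ d₂ d₃ : ℕ} (E : Fin d₁ × Fin d₂ × Fin d₃ → ℝ) (s₁ s₂ s₃ : ℕ)
    (u : Fin d₁ → ℝ) (v : Fin d₂ → ℝ) (w : Fin d₃ → ℝ)
    (hu : l2 u = 1) (hv : l2 v = 1) (hw : l2 w = 1)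
    (h1 : (Function.support u).ncard ≤ s₁) (h2 : (Function.support v).ncard ≤ s₂)
    (h3 : (Function.support w).ncard ≤ s₃) :
    |∑ i, ∑ j, ∑ k, E (i, j, k) * u i * v j * w k| ≤ eta E s₁ s₂ s₃ := by
  refine le_csSup ?_ ⟨u, v, w, hu, hv, hw, h1, h2, h3, rfl⟩
  refine ⟨∑ i, ∑ j, ∑ k, |E (i, j, k)|, ?_⟩
  rintro x ⟨u, v, w, hu, hv, hw, -, -, -, rfl⟩
  refine (Finset.abs_sum_le_sum_abs _ _).trans (Finset.sum_le_sum fun i _ => ?_)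
  refine (Finset.abs_sum_le_sum_abs _ _).trans (Finset.sum_le_sum fun j _ => ?_)
  refine (Finset.abs_sum_le_sum_abs _ _).trans (Finset.sum_le_sum fun k _ => ?_)
  rw [abs_mul, abs_mul, abs_mul]
  have a := hu ▸ abs_le_l2 u i
  have b := hv ▸ abs_le_l2 v j
  have c := hw ▸ abs_le_l2 w k
  have h1 : |E (i, j, k)| * |u i| ≤ |E (i, j, k)| := mul_le_of_le_one_right (abs_nonneg _) a
  have h2 := mul_le_of_le_one_right (mul_nonneg (abs_nonneg (E (i, j, k))) (abs_nonneg (u i))) b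
  have h3 := mul_le_of_le_one_right (mul_nonneg (mul_nonneg (abs_nonneg (E (i, j, k))) (abs_nonneg (u i))) (abs_nonneg (v j))) c
  linarith

lemma inner_bound {d : ℕ} (u b : Fin d → ℝ) (hu : l2 u = 1) (hb : l2 b = 1) (ε : ℝ)
    (h : l2 (fun i => u i - b i) ≤ ε) : 1 - ε ^ 2 / 2 ≤ ∑ i, b i * u i := by
  have h1 := l2_sq u
  have h2 := l2_sq b
  have h3 := l2_sq (fun i => u i - b i)
  have h4 : l2 (fun i => u i - b i) ^ 2 ≤ ε ^ 2 := pow_le_pow_left₀ (l2_nonneg _) h 2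
  have h5 : ∑ i, (u i - b i) ^ 2 = ∑ i, u i ^ 2 + ∑ i, b i ^ 2 - 2 * ∑ i, b i * u i := by
    rw [Finset.mul_sum, ← Finset.sum_add_distrib, ← Finset.sum_sub_distrib]
    exact Finset.sum_congr rfl fun i _ => by ring
  rw [hu] at h1
  rw [hb] at h2
  linarith

lemma ncard_le_of_subset {d : ℕ} (u : Fin d → ℝ) (F : Finset (Fin d)) (s : ℕ)
    (h : Function.support u ⊆ ↑F) (hc : F.card ≤ s) : (Function.support u).ncard ≤ s := by
  have := Set.ncard_le_ncard h F.finite_toSet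
  rw [Set.ncard_coe_finset] at this
  omega

lemma err_le {d₁ d₂ d₃ : ℕ} (E : Fin d₁ × Fin d₂ × Fin d₃ → ℝ) (s₁ s₂ s₃ : ℕ)
    (u : Fin d₁ → ℝ) (v : Fin d₂ → ℝ) (hu : l2 u = 1) (hv : l2 v = 1)
    (h1 : (Function.support u).ncard ≤ s₁) (h2 : (Function.support v).ncard ≤ s₂)
    (F : Finset (Fin d₃)) (hF : F.card ≤ s₃) :
    l2 (fun k => if k ∈ F then ∑ i, ∑ j, E (i, j, k) * u i * v j else 0) ≤ eta E s₁ s₂ s₃ := by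
  set e : Fin d₃ → ℝ := fun k => if k ∈ F then ∑ i, ∑ j, E (i, j, k) * u i * v j else 0 with he
  rcases (l2_nonneg e).eq_or_lt with h0 | h0
  · rw [← h0]; exact eta_nonneg _ _ _ _
  have hw : l2 (fun k => e k / l2 e) = 1 := by
    have := l2_sq (fun k => e k / l2 e)
    simp only [div_pow] at this
    rw [← Finset.sum_div, ← l2_sq, div_self (by positivity)] at this
    nlinarith [l2_nonneg (fun k => e k / l2 e)]
  have h3 : (Function.support (fun k => e k / l2 e)).ncard ≤ s₃ := by
    refine ncard_le_of_subset _ F _ ?_ hF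
    intro k hk
    by_contra hk'
    apply hk
    have : k ∉ F := hk'
    simp [he, this]
  have key := le_eta E s₁ s₂ s₃ u v _ hu hv hw h1 h2 h3
  have hs : ∑ i, ∑ j, ∑ k, E (i, j, k) * u i * v j * (e k / l2 e) = l2 e := by
    have : ∑ i, ∑ j, ∑ k, E (i, j, k) * u i * v j * (e k / l2 e)
        = ∑ k, (∑ i, ∑ j, E (i, j, k) * u i * v j) * (e k / l2 e) := by
      simp only [Finset.sum_mul]
      rw [Finset.sum_comm' (t' := Finset.univ) (s' := fun _ => Finset.univ) (by simp)]
      rw [Finset.sum_comm]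
      rw [Finset.sum_comm]
      rw [Finset.sum_congr rfl fun i _ => Finset.sum_comm]
      rw [Finset.sum_comm]
      refine Finset.sum_congr rfl fun k _ => ?_
      rw [Finset.sum_comm]
    rw [this]
    have h : ∀ k, (∑ i, ∑ j, E (i, j, k) * u i * v j) * (e k / l2 e) = e k ^ 2 / l2 e := by
      intro k
      by_cases hk : k ∈ F
      · have : e k = ∑ i, ∑ j, E (i, j, k) * u i * v j := by simp [he, hk]
        rw [← this]; ring
      · have : e k = 0 := by simp [he, hk]
        rw [this]; simp
    rw [Finset.sum_congr rfl fun k _ => h k, ← Finset.sum_div, ← l2_sq]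
    field_simp
  rw [hs] at key
  exact (le_abs_self _).trans key

lemma contract_eq {d₁ d₂ d₃ : ℕ} (wstar : ℝ)
    (β₁ : Fin d₁ → ℝ) (β₂ : Fin d₂ → ℝ) (β₃ : Fin d₃ → ℝ)
    (E : Fin d₁ × Fin d₂ × Fin d₃ → ℝ)
    (u : Fin d₁ → ℝ) (v : Fin d₂ → ℝ)
    (F₁ : Finset (Fin d₁)) (F₂ : Finset (Fin d₂)) (F₃ : Finset (Fin d₃))
    (hF₁ : Function.support u ⊆ ↑F₁) (hF₂ : Function.support v ⊆ ↑F₂)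
    (hF₃ : Function.support β₃ ⊆ ↑F₃) (k : Fin d₃) :
    contract3 (restrict3 (fun p => wstar * outer3 β₁ β₂ β₃ p + E p) F₁ F₂ F₃) u v k
      = wstar * ((∑ i, β₁ i * u i) * (∑ j, β₂ j * v j)) * β₃ k +
        (if k ∈ F₃ then ∑ i, ∑ j, E (i, j, k) * u i * v j else 0) := by
  have hu : ∀ i, i ∉ F₁ → u i = 0 := fun i hi => by
    by_contra h; exact hi (hF₁ h)
  have hv : ∀ i, i ∉ F₂ → v i = 0 := fun i hi => by
    by_contra h; exact hi (hF₂ h)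
  unfold contract3 restrict3 outer3
  by_cases hk : k ∈ F₃
  · simp only [hk, and_true, if_true]
    rw [Finset.sum_mul_sum, Finset.mul_sum, Finset.sum_mul, ← Finset.sum_add_distrib]
    refine Finset.sum_congr rfl fun i _ => ?_
    rw [Finset.mul_sum, Finset.sum_mul, ← Finset.sum_add_distrib]
    refine Finset.sum_congr rfl fun j _ => ?_
    by_cases hi : i ∈ F₁
    · by_cases hj : j ∈ F₂
      · simp only [hi, hj, and_self, if_true]; ring
      · simp [hv j hj]
    · simp [hu i hi]
  · have : β₃ k = 0 := by
      by_contra h; exact hk (hF₃ h)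
    simp [hk, this]

/-- Key sup-norm error bound in the proof of Theorem 1 of the paper. -/
theorem statement1 {d₁ d₂ d₃ : ℕ}
    (wstar : ℝ) (hw : 0 < wstar)
    (β₁ : Fin d₁ → ℝ) (β₂ : Fin d₂ → ℝ) (β₃ : Fin d₃ → ℝ)
    (hβ₁ : l2 β₁ = 1) (hβ₂ : l2 β₂ = 1) (hβ₃ : l2 β₃ = 1)
    (E T : Fin d₁ × Fin d₂ × Fin d₃ → ℝ)
    (hT : T = fun p => wstar * outer3 β₁ β₂ β₃ p + E p)
    (u : Fin d₁ → ℝ) (v : Fin d₂ → ℝ) (hu : l2 u = 1) (hv : l2 v = 1)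
    (ε₀ : ℝ) (hε₀0 : 0 ≤ ε₀) (hε₀1 : ε₀ < 1)
    (hu' : l2 (fun i => u i - β₁ i) ≤ ε₀) (hv' : l2 (fun i => v i - β₂ i) ≤ ε₀)
    (s₁ s₂ s₃ : ℕ)
    (F₁ : Finset (Fin d₁)) (F₂ : Finset (Fin d₂)) (F₃ : Finset (Fin d₃))
    (hF₁ : Function.support u ∪ Function.support β₁ ⊆ ↑F₁) (hF₁c : F₁.card ≤ s₁)
    (hF₂ : Function.support v ∪ Function.support β₂ ⊆ ↑F₂) (hF₂c : F₂.card ≤ s₂)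
    (hF₃ : Function.support β₃ ⊆ ↑F₃) (hF₃c : F₃.card ≤ s₃)
    (hη : eta E s₁ s₂ s₃ < wstar * (1 - ε₀ ^ 2)) :
    linf (fun k => vnormalize (contract3 (restrict3 T F₁ F₂ F₃) u v) k - β₃ k)
      ≤ 2 * eta E s₁ s₂ s₃ / (wstar * (1 - ε₀ ^ 2) - eta E s₁ s₂ s₃) := by
  have hη0 := eta_nonneg E s₁ s₂ s₃
  have hden : 0 < wstar * (1 - ε₀ ^ 2) - eta E s₁ s₂ s₃ := by linarith
  have hu1 := inner_bound u β₁ hu hβ₁ ε₀ hu'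
  have hv1 := inner_bound v β₂ hv hβ₂ ε₀ hv'
  have hE := err_le E s₁ s₂ s₃ u v hu hv
    (ncard_le_of_subset u F₁ s₁ (Set.subset_union_left.trans hF₁) hF₁c)
    (ncard_le_of_subset v F₂ s₂ (Set.subset_union_left.trans hF₂) hF₂c) F₃ hF₃c
  have hx := contract_eq wstar β₁ β₂ β₃ E u v F₁ F₂ F₃
    (Set.subset_union_left.trans hF₁) (Set.subset_union_left.trans hF₂) hF₃
  rw [← hT] at hx
  set x := contract3 (restrict3 T F₁ F₂ F₃) u v
  set e : Fin d₃ → ℝ := fun k => if k ∈ F₃ then ∑ i, ∑ j, E (i, j, k) * u i * v j else 0 with he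
  set a := ∑ i, β₁ i * u i
  set b := ∑ j, β₂ j * v j
  set η := eta E s₁ s₂ s₃
  have hab : 1 - ε₀ ^ 2 ≤ a * b := by
    have h1 : 0 ≤ 1 - ε₀ ^ 2 / 2 := by nlinarith
    have h2 := mul_le_mul hu1 hv1 h1 (h1.trans hu1)
    nlinarith [sq_nonneg (ε₀ ^ 2)]
  have hc : wstar * (1 - ε₀ ^ 2) ≤ wstar * (a * b) := mul_le_mul_of_nonneg_left hab hw.le
  set c := wstar * (a * b)
  have hc0 : 0 ≤ c := by linarith
  have hxe : (WithLp.toLp 2 x : EuclideanSpace ℝ (Fin d₃)) =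
      c • (WithLp.toLp 2 β₃ : EuclideanSpace ℝ (Fin d₃)) + WithLp.toLp 2 e := by
    ext k
    simpa [he] using hx k
  have hβn : ‖c • (WithLp.toLp 2 β₃ : EuclideanSpace ℝ (Fin d₃))‖ = c := by
    rw [norm_smul, ← l2_eq_norm, hβ₃, mul_one, Real.norm_of_nonneg hc0]
  have hdiff : |l2 x - c| ≤ η := by
    have := abs_norm_sub_norm_le (WithLp.toLp 2 x : EuclideanSpace ℝ (Fin d₃))
      (c • (WithLp.toLp 2 β₃ : EuclideanSpace ℝ (Fin d₃)))
    rw [hβn, hxe, add_sub_cancel_left, ← hxe, ← l2_eq_norm, ← l2_eq_norm] at this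
    exact this.trans hE
  have hd := abs_le.1 hdiff
  have hxpos : wstar * (1 - ε₀ ^ 2) - η ≤ l2 x := by linarith
  have hx0 : 0 < l2 x := by linarith
  refine Real.iSup_le (fun k => ?_) (by positivity)
  have hk : vnormalize x k - β₃ k = ((c - l2 x) * β₃ k + e k) / l2 x := by
    unfold vnormalize
    rw [hx k]
    simp only [he]
    field_simp
    ring
  beta_reduce
  rw [hk, abs_div, abs_of_pos hx0]
  have hn : |(c - l2 x) * β₃ k + e k| ≤ 2 * η := by
    have h1 := abs_add_le ((c - l2 x) * β₃ k) (e k)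
    have h2 : |(c - l2 x) * β₃ k| ≤ η * 1 := by
      rw [abs_mul, abs_sub_comm]
      exact mul_le_mul hdiff (hβ₃ ▸ abs_le_l2 β₃ k) (abs_nonneg _) hη0
    have h3 := (abs_le_l2 e k).trans hE
    linarith
  exact div_le_div₀ (by positivity) hn hden hxpos
end

section
/- There exists a constant C > 0 such that for all positive integers d₁, d₂, d₃ with d₁d₂d₃ ≥ 2 and all 1 ≤ s₁ ≤ d₁, 1 ≤ s₂ ≤ d₂, 1 ≤ s₃ ≤ d₃ the following holds: if G ∈ ℝ^{d₁×d₂×d₃} is a random tensor whose entries are independent standard Gaussian N(0,1) random variables, then E[ η(G; s₁,s₂,s₃) ] ≤ C √( s₁ s₂ s₃ log(d₁ d₂ d₃) ). -/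
open scoped BigOperators
open Matrix

open MeasureTheory ProbabilityTheory

lemma aux_l1 {d s : ℕ} (v : Fin d → ℝ) (h : l2 v = 1)
    (hs : (Function.support v).ncard ≤ s) : ∑ i, |v i| ≤ Real.sqrt s := by
  classical
  have h1 : ∑ i, v i ^ 2 = 1 := by
    unfold l2 at h
    exact Real.sqrt_eq_one.mp h
  have hF : (Function.support v).ncard = (Finset.univ.filter fun i => v i ≠ 0).card := by
    rw [← Set.ncard_coe_finset]
    congr 1
    ext i
    simp
  have h2 : ∑ i, |v i| = ∑ i ∈ Finset.univ.filter (fun i => v i ≠ 0), |v i| := by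
    rw [Finset.sum_filter]
    refine Finset.sum_congr rfl fun i _ => ?_
    by_cases hi : v i = 0 <;> simp [hi]
  have h3 : ∑ i ∈ Finset.univ.filter (fun i => v i ≠ 0), |v i| ^ 2 ≤ 1 := by
    rw [← h1]
    simp only [sq_abs]
    exact Finset.sum_le_sum_of_subset_of_nonneg (Finset.filter_subset _ _)
      (fun i _ _ => sq_nonneg _)
  apply Real.le_sqrt_of_sq_le
  rw [h2]
  refine (sq_sum_le_card_mul_sum_sq).trans ?_
  rw [hF] at hs
  have hs' : ((Finset.univ.filter fun i => v i ≠ 0).card : ℝ) ≤ s := by exact_mod_cast hs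
  calc _ ≤ ((Finset.univ.filter fun i => v i ≠ 0).card : ℝ) * 1 := by gcongr
    _ ≤ s := by linarith

lemma aux_eta {d₁ d₂ d₃ : ℕ} (G : Fin d₁ × Fin d₂ × Fin d₃ → ℝ) (s₁ s₂ s₃ : ℕ) (B : ℝ)
    (hB0 : 0 ≤ B) (hB : ∀ p, |G p| ≤ B) :
    eta G s₁ s₂ s₃ ≤ B * Real.sqrt ((s₁ : ℝ) * s₂ * s₃) := by
  unfold eta
  refine Real.sSup_le ?_ (by positivity)
  rintro x ⟨u, v, w, hu, hv, hw, su, sv, sw, rfl⟩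
  have h1 := aux_l1 u hu su
  have h2 := aux_l1 v hv sv
  have h3 := aux_l1 w hw sw
  calc |∑ i, ∑ j, ∑ k, G (i, j, k) * u i * v j * w k|
      ≤ ∑ i, ∑ j, ∑ k, |G (i, j, k) * u i * v j * w k| := by
        refine (Finset.abs_sum_le_sum_abs _ _).trans (Finset.sum_le_sum fun i _ => ?_)
        refine (Finset.abs_sum_le_sum_abs _ _).trans (Finset.sum_le_sum fun j _ => ?_)
        exact Finset.abs_sum_le_sum_abs _ _
    _ ≤ ∑ i, ∑ j, ∑ k, B * |u i| * |v j| * |w k| := by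
        refine Finset.sum_le_sum fun i _ => Finset.sum_le_sum fun j _ =>
          Finset.sum_le_sum fun k _ => ?_
        rw [abs_mul, abs_mul, abs_mul]
        gcongr
        exact hB _
    _ = B * ((∑ i, |u i|) * (∑ j, |v j|) * ∑ k, |w k|) := by
        simp only [← Finset.mul_sum, ← Finset.sum_mul]
        ring
    _ ≤ B * (Real.sqrt s₁ * Real.sqrt s₂ * Real.sqrt s₃) := by
        gcongr
    _ = _ := by
        rw [Real.sqrt_mul (by positivity), Real.sqrt_mul (by positivity)]

lemma aux_exp {ι : Type*} [Fintype ι] (p : ι) (t : ℝ) :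
    Integrable (fun G : ι → ℝ => Real.exp (t * G p)) (Measure.pi fun _ : ι => gaussianReal 0 1) ∧
    ∫ G : ι → ℝ, Real.exp (t * G p) ∂(Measure.pi fun _ : ι => gaussianReal 0 1)
      = Real.exp (t ^ 2 / 2) := by
  have hm : (Measure.pi fun _ : ι => gaussianReal 0 1).map (fun G : ι → ℝ => G p)
      = gaussianReal 0 1 :=
    (measurePreserving_eval (fun _ : ι => gaussianReal 0 1) p).map_eq
  have h := mgf_gaussianReal hm t
  constructor
  · rw [← mgf_pos_iff, h]
    exact Real.exp_pos _
  · unfold mgf at h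
    rw [h]
    simp

lemma aux_pt {ι : Type*} [Fintype ι] (G : ι → ℝ) (a l : ℝ) (hl : 0 < l) (p : ι) :
    |G p| ≤ (a - 1 + Real.exp (-a) * ∑ q, (Real.exp (l * G q) + Real.exp (-l * G q))) / l := by
  rw [le_div_iff₀ hl]
  have h1 : Real.exp (l * |G p|) ≤ ∑ q, (Real.exp (l * G q) + Real.exp (-l * G q)) := by
    refine le_trans ?_ (Finset.single_le_sum
      (f := fun q => Real.exp (l * G q) + Real.exp (-l * G q))
      (fun q _ => by positivity) (Finset.mem_univ p))
    have e1 := Real.exp_pos (l * G p)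
    have e2 := Real.exp_pos (-l * G p)
    rcases abs_cases (G p) with ⟨h, _⟩ | ⟨h, _⟩ <;> rw [h]
    · linarith
    · rw [mul_neg, ← neg_mul]
      linarith
  have h2 := Real.add_one_le_exp (l * |G p| - a)
  have h3 : Real.exp (l * |G p| - a) = Real.exp (-a) * Real.exp (l * |G p|) := by
    rw [← Real.exp_add]; ring_nf
  have h4 := mul_le_mul_of_nonneg_left h1 (Real.exp_pos (-a)).le
  linarith


/-- Step 2 in the proof of Corollary 2: expected sparse spectral norm of a
standard Gaussian tensor. -/
theorem statement10 :
    ∃ C : ℝ, 0 < C ∧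
      ∀ d₁ d₂ d₃ s₁ s₂ s₃ : ℕ, 0 < d₁ → 0 < d₂ → 0 < d₃ → 2 ≤ d₁ * d₂ * d₃ →
        1 ≤ s₁ → s₁ ≤ d₁ → 1 ≤ s₂ → s₂ ≤ d₂ → 1 ≤ s₃ → s₃ ≤ d₃ →
        (∫ G : Fin d₁ × Fin d₂ × Fin d₃ → ℝ, eta G s₁ s₂ s₃
          ∂(Measure.pi fun _ : Fin d₁ × Fin d₂ × Fin d₃ => gaussianReal 0 1))
        ≤ C * Real.sqrt ((s₁ : ℝ) * s₂ * s₃ * Real.log ((d₁ : ℝ) * d₂ * d₃)) := by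
  refine ⟨3, by norm_num, ?_⟩
  intro d₁ d₂ d₃ s₁ s₂ s₃ hd₁ hd₂ hd₃ hN _ _ _ _ _ _
  set μ := (Measure.pi fun _ : Fin d₁ × Fin d₂ × Fin d₃ => gaussianReal 0 1) with hμ
  have hN' : (2 : ℝ) ≤ (d₁ : ℝ) * d₂ * d₃ := by exact_mod_cast hN
  set N : ℝ := (d₁ : ℝ) * d₂ * d₃ with hNdef
  set L := Real.log N with hL
  have hL2 : Real.log 2 ≤ L := Real.log_le_log (by norm_num) hN'
  have hlog2 : 0 < Real.log 2 := Real.log_pos (by norm_num)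
  have hLpos : 0 < L := by linarith
  set l := Real.sqrt L with hl
  have hlpos : 0 < l := Real.sqrt_pos.mpr hLpos
  have hll : l ^ 2 = L := Real.sq_sqrt hLpos.le
  set a := Real.log 2 + L + l ^ 2 / 2 with ha
  let B : (Fin d₁ × Fin d₂ × Fin d₃ → ℝ) → ℝ := fun G =>
    (a - 1 + Real.exp (-a) * ∑ q, (Real.exp (l * G q) + Real.exp (-l * G q))) / l
  have hB : ∀ G p, |G p| ≤ B G := fun G p => aux_pt G a l hlpos p
  have p0 : Fin d₁ × Fin d₂ × Fin d₃ := (⟨0, hd₁⟩, ⟨0, hd₂⟩, ⟨0, hd₃⟩)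
  have hB0 : ∀ G, 0 ≤ B G := fun G => (abs_nonneg _).trans (hB G p0)
  have i1 : Integrable (fun G : Fin d₁ × Fin d₂ × Fin d₃ → ℝ =>
      ∑ q, (Real.exp (l * G q) + Real.exp (-l * G q))) μ :=
    integrable_finsetSum _ fun q _ => (aux_exp q l).1.add (aux_exp q (-l)).1
  have iB : Integrable B μ :=
    ((integrable_const (a - 1)).add (i1.const_mul (Real.exp (-a)))).div_const l
  have e1 : ∫ G, (∑ q, (Real.exp (l * G q) + Real.exp (-l * G q))) ∂μ
      = 2 * N * Real.exp (l ^ 2 / 2) := by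
    have i0 : ∀ q : Fin d₁ × Fin d₂ × Fin d₃,
        Integrable (fun G => Real.exp (l * G q) + Real.exp (-l * G q)) μ :=
      fun q => (aux_exp q l).1.add (aux_exp q (-l)).1
    rw [integral_finsetSum _ fun q _ => i0 q]
    have : ∀ q : Fin d₁ × Fin d₂ × Fin d₃,
        ∫ G, (Real.exp (l * G q) + Real.exp (-l * G q)) ∂μ = 2 * Real.exp (l ^ 2 / 2) := by
      intro q
      rw [integral_add (aux_exp q l).1 (aux_exp q (-l)).1, (aux_exp q l).2, (aux_exp q (-l)).2,
        neg_sq]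
      ring
    simp only [this, Finset.sum_const, Finset.card_univ, Fintype.card_prod, Fintype.card_fin,
      nsmul_eq_mul, Nat.cast_mul, hNdef]
    ring
  have e2 : Real.exp (-a) * (2 * N * Real.exp (l ^ 2 / 2)) = 1 := by
    have : Real.exp a = 2 * N * Real.exp (l ^ 2 / 2) := by
      rw [ha, Real.exp_add, Real.exp_add, Real.exp_log (by norm_num), hL,
        Real.exp_log (by linarith)]
    rw [← this, ← Real.exp_add]
    simp
  have eB : ∫ G, B G ∂μ = a / l := by
    simp only [B]
    rw [integral_div, integral_add (integrable_const _) (i1.const_mul _), integral_const_mul,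
      e1, e2]
    simp
  have hal : a / l ≤ 3 * l := by
    rw [div_le_iff₀ hlpos, ha]
    nlinarith
  calc ∫ G, eta G s₁ s₂ s₃ ∂μ
      ≤ ∫ G, B G * Real.sqrt ((s₁ : ℝ) * s₂ * s₃) ∂μ := by
        refine integral_mono_of_nonneg (Filter.Eventually.of_forall fun G => ?_)
          (iB.mul_const _)
          (Filter.Eventually.of_forall fun G => aux_eta G s₁ s₂ s₃ (B G) (hB0 G) (hB G))
        refine Real.sSup_nonneg ?_
        rintro x ⟨u, v, w, _, _, _, _, _, _, rfl⟩
        exact abs_nonneg _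
    _ = a / l * Real.sqrt ((s₁ : ℝ) * s₂ * s₃) := by rw [integral_mul_const, eB]
    _ ≤ 3 * l * Real.sqrt ((s₁ : ℝ) * s₂ * s₃) := by gcongr
    _ = 3 * Real.sqrt ((s₁ : ℝ) * s₂ * s₃ * L) := by
        rw [Real.sqrt_mul (show (0 : ℝ) ≤ (s₁ : ℝ) * s₂ * s₃ by positivity) L]
        ring
end
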